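/- arXiv:2002.07011 — 2 statements merged into one kernel-verified Lean document; each statement's English description precedes it below -/
import Mathlib

section
/- Let γ > 0, let T be a subset of ℝ, and let f : ℝ³ × T → [0,∞) be measurable such that sup_{t∈T} ‖F_γ∘f(·,t)‖_{L^{3/2}(ℝ³)} < ∞. Then lim_{r→0+} sup_{t∈T} sup_{x₀∈ℝ³} ∫_{B_r(x₀)} f(x,t)/|x−x₀| dx = 0. -/
open MeasureTheory Real Filter Topology

/-- Over small balls centered at the origin of `ℝ³`, the integral of a locally integrable radial
function tends to zero with the radius. -/
lemma tendsto_setLIntegral_ball_radial {φ : ℝ → ℝ} {c : ℝ} (hc : 0 < c)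
    (hφ : IntegrableOn (fun s => s ^ 2 * φ s) (Set.Ioo 0 c)) :
    Tendsto (fun r : ℝ => ∫⁻ x in Metric.ball (0 : EuclideanSpace ℝ (Fin 3)) r,
      ENNReal.ofReal (φ ‖x‖)) (𝓝[>] 0) (𝓝 0) := by
  have hint : IntegrableOn (fun x : EuclideanSpace ℝ (Fin 3) => φ ‖x‖) (Metric.ball 0 c) volume := by
    rw [integrableOn_fun_norm_addHaar]
    simpa using hφ
  have hvol : Tendsto (fun r : ℝ => volume (Metric.ball (0 : EuclideanSpace ℝ (Fin 3)) r))
      (𝓝[>] 0) (𝓝 0) := by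
    have h : Tendsto (fun r : ℝ => ENNReal.ofReal (r ^ 3) *
        volume (Metric.ball (0 : EuclideanSpace ℝ (Fin 3)) 1)) (𝓝[>] 0) (𝓝 0) := by
      have h3 : Tendsto (fun r : ℝ => ENNReal.ofReal (r ^ 3)) (𝓝[>] 0) (𝓝 0) := by
        have : Continuous fun r : ℝ => ENNReal.ofReal (r ^ 3) :=
          ENNReal.continuous_ofReal.comp (continuous_pow 3)
        simpa using (this.tendsto 0).mono_left nhdsWithin_le_nhds
      have h4 := ENNReal.Tendsto.mul_const h3 (Or.inr (measure_ball_lt_top (μ := volume)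
        (x := (0 : EuclideanSpace ℝ (Fin 3))) (r := 1)).ne)
      rwa [zero_mul] at h4
    refine h.congr' ?_
    filter_upwards [self_mem_nhdsWithin] with r hr
    rw [Measure.addHaar_ball _ _ (le_of_lt hr)]
    simp
  have hlim := tendsto_setLIntegral_zero
    ((integrable_indicator_iff measurableSet_ball).2 hint).lintegral_lt_top.ne hvol
  refine hlim.congr' ?_
  filter_upwards [Ioo_mem_nhdsGT hc] with r hr
  refine setLIntegral_congr_fun measurableSet_ball fun x hx => ?_
  simp only [Set.indicator_of_mem (Metric.ball_subset_ball hr.2.le hx)]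

lemma setLIntegral_ball_sub (φ : EuclideanSpace ℝ (Fin 3) → ENNReal)
    (x₀ : EuclideanSpace ℝ (Fin 3)) (r : ℝ) :
    ∫⁻ x in Metric.ball x₀ r, φ (x - x₀) = ∫⁻ x in Metric.ball 0 r, φ x := by
  have h := (measurePreserving_sub_right volume x₀).setLIntegral_comp_preimage_emb
    (MeasurableEquiv.subRight x₀).measurableEmbedding φ (Metric.ball 0 r)
  rw [← h]
  congr 2
  ext x
  simp [dist_eq_norm]

lemma integrableOn_inv_mul_neg_log_pow_three :
    IntegrableOn (fun s : ℝ => s ^ 2 * (s⁻¹ * (-Real.log s)⁻¹) ^ 3) (Set.Ioo 0 (Real.exp (-1))) := by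
  have hI : IntegrableOn (fun s : ℝ => 2 * (s⁻¹ * ((-Real.log s)⁻¹) ^ 3))
      (Set.Ioc 0 (Real.exp (-1))) := by
    refine intervalIntegral.integrableOn_deriv_of_nonneg
      (g := fun s => ((-Real.log s)⁻¹) ^ 2) ?_ ?_ ?_
    · intro s hs
      apply ContinuousAt.continuousWithinAt
      rcases hs.1.eq_or_lt with h0 | h0
      · subst h0
        rw [continuousAt_iff_punctured_nhds]
        have h := (tendsto_inv_atTop_zero.comp
          (tendsto_neg_atBot_atTop.comp Real.tendsto_log_nhdsNE_zero)).pow 2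
        simpa [Function.comp_def] using h
      · have hl : Real.log s < 0 :=
          Real.log_neg h0 (hs.2.trans_lt (by rw [Real.exp_lt_one_iff]; norm_num))
        have := Real.continuousAt_log h0.ne'
        exact (this.neg.inv₀ (neg_ne_zero.2 hl.ne)).pow 2
    · intro s hs
      have hl : Real.log s < 0 :=
        Real.log_neg hs.1 (hs.2.trans (by rw [Real.exp_lt_one_iff]; norm_num))
      have hl' : -Real.log s ≠ 0 := by linarith
      have hs0 := hs.1.ne'
      have h := (((Real.hasDerivAt_log hs0).neg).inv hl').pow 2
      refine HasDerivAt.congr_deriv (f := fun s => ((-Real.log s)⁻¹) ^ 2) h ?_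
      simp only [Pi.neg_apply, Pi.inv_apply]
      have := hl.ne
      norm_num
      field_simp
    · intro s hs
      have hl : Real.log s < 0 :=
        Real.log_neg hs.1 (hs.2.trans (by rw [Real.exp_lt_one_iff]; norm_num))
      have := hs.1
      have : 0 < -Real.log s := by linarith
      positivity
  have h2 := (hI.mono_set Set.Ioo_subset_Ioc_self).const_mul (1 / 2)
  refine IntegrableOn.congr_fun h2 (fun s hs => ?_) measurableSet_Ioo
  have hs0 := hs.1.ne'
  simp only [mul_pow]
  field_simp

/-- Where `a` exceeds the singularity `1 / s`, the logarithm in `a log (1 + a) ^ (1 + γ)` beats the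
one of `1 / s`. -/
lemma div_le_inv_sq_add_mul_log_rpow {γ a s : ℝ} (hγ : 0 < γ) (ha : 0 ≤ a) (hs : 0 < s)
    (hs' : s < Real.exp (-1)) :
    a / s ≤ s⁻¹ ^ 2 + a * Real.log (1 + a) ^ (1 + γ) * (s⁻¹ * (-Real.log s)⁻¹) := by
  have hl : 1 < -Real.log s := by
    have := Real.log_lt_log hs hs'
    rw [Real.log_exp] at this
    linarith
  have hsi : 0 < s⁻¹ := inv_pos.2 hs
  have hl0 : 0 ≤ Real.log (1 + a) := Real.log_nonneg (by linarith)
  rcases le_total a s⁻¹ with h | h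
  · have h1 : a / s ≤ s⁻¹ ^ 2 := by
      rw [div_eq_mul_inv, sq]
      gcongr
    have h2 : 0 ≤ a * Real.log (1 + a) ^ (1 + γ) * (s⁻¹ * (-Real.log s)⁻¹) := by
      have : 0 < -Real.log s := by linarith
      positivity
    linarith
  · have h1 : -Real.log s ≤ Real.log (1 + a) := by
      rw [← Real.log_inv]
      exact Real.log_le_log hsi (by linarith)
    have h2 : -Real.log s ≤ Real.log (1 + a) ^ (1 + γ) :=
      h1.trans (Real.self_le_rpow_of_one_le (by linarith) (by linarith))
    have h3 : 1 ≤ Real.log (1 + a) ^ (1 + γ) * (-Real.log s)⁻¹ := by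
      rw [← div_eq_mul_inv, one_le_div (by linarith)]
      exact h2
    have h4 : a / s * 1 ≤ a / s * (Real.log (1 + a) ^ (1 + γ) * (-Real.log s)⁻¹) := by
      gcongr
    have h5 : a / s * (Real.log (1 + a) ^ (1 + γ) * (-Real.log s)⁻¹) =
        a * Real.log (1 + a) ^ (1 + γ) * (s⁻¹ * (-Real.log s)⁻¹) := by
      ring
    have h6 : 0 ≤ s⁻¹ ^ 2 := by positivity
    linarith

lemma setLIntegral_div_dist_le {γ r : ℝ} (hγ : 0 < γ) (hr : r < Real.exp (-1))
    {g : EuclideanSpace ℝ (Fin 3) → ℝ} (hg : Measurable g) (hg0 : ∀ x, 0 ≤ g x)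
    (x₀ : EuclideanSpace ℝ (Fin 3)) :
    ∫⁻ x in Metric.ball x₀ r, ENNReal.ofReal (g x) / ENNReal.ofReal ‖x - x₀‖ ≤
      (∫⁻ x in Metric.ball (0 : EuclideanSpace ℝ (Fin 3)) r, ENNReal.ofReal (‖x‖⁻¹ ^ 2)) +
      eLpNorm (fun x => g x * Real.log (1 + g x) ^ (1 + γ)) (3 / 2) volume *
      (∫⁻ x in Metric.ball (0 : EuclideanSpace ℝ (Fin 3)) r,
        ENNReal.ofReal ((‖x‖⁻¹ * (-Real.log ‖x‖)⁻¹) ^ 3)) ^ (1 / 3 : ℝ) := by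
  set F : EuclideanSpace ℝ (Fin 3) → ℝ := fun x => g x * Real.log (1 + g x) ^ (1 + γ) with hF
  have hFm : Measurable F := by fun_prop
  have hF0 : ∀ x, 0 ≤ F x := fun x =>
    mul_nonneg (hg0 x) (Real.rpow_nonneg (Real.log_nonneg (by linarith [hg0 x])) _)
  set k : ℝ → ℝ := fun s => s⁻¹ * (-Real.log s)⁻¹ with hk
  have hkm : Measurable k := by fun_prop
  have hk0 : ∀ s, 0 ≤ s → s < Real.exp (-1) → 0 ≤ k s := fun s hs hs' => by
    have : Real.log s ≤ 0 :=
      Real.log_nonpos hs (hs'.le.trans (by rw [Real.exp_le_one_iff]; norm_num))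
    exact mul_nonneg (inv_nonneg.2 hs) (inv_nonneg.2 (by linarith))
  calc
    _ ≤ ∫⁻ x in Metric.ball x₀ r, (ENNReal.ofReal (‖x - x₀‖⁻¹ ^ 2) +
        ENNReal.ofReal (F x) * ENNReal.ofReal (k ‖x - x₀‖)) := by
      refine lintegral_mono_ae ?_
      have hne : ∀ᵐ x ∂(volume.restrict (Metric.ball x₀ r)), x ≠ x₀ :=
        ae_restrict_of_ae (Measure.ae_ne volume x₀)
      filter_upwards [hne, ae_restrict_mem measurableSet_ball] with x hx hxr
      have hs : 0 < ‖x - x₀‖ := norm_pos_iff.2 (sub_ne_zero.2 hx)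
      have hs' : ‖x - x₀‖ < Real.exp (-1) := (mem_ball_iff_norm.1 hxr).trans hr
      rw [← ENNReal.ofReal_div_of_pos hs, ← ENNReal.ofReal_mul (hF0 x),
        ← ENNReal.ofReal_add (by positivity) (mul_nonneg (hF0 x) (hk0 _ hs.le hs'))]
      exact ENNReal.ofReal_le_ofReal (div_le_inv_sq_add_mul_log_rpow hγ (hg0 x) hs hs')
    _ = (∫⁻ x in Metric.ball x₀ r, ENNReal.ofReal (‖x - x₀‖⁻¹ ^ 2)) +
        ∫⁻ x in Metric.ball x₀ r, ENNReal.ofReal (F x) * ENNReal.ofReal (k ‖x - x₀‖) :=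
      lintegral_add_left (by fun_prop) _
    _ ≤ _ := by
      gcongr ?_ + ?_
      · exact (setLIntegral_ball_sub (fun y => ENNReal.ofReal (‖y‖⁻¹ ^ 2)) x₀ r).le
      · have hpq : (3 / 2 : ℝ).HolderConjugate 3 := by
          rw [Real.holderConjugate_iff]; norm_num
        refine (ENNReal.lintegral_mul_le_Lp_mul_Lq _ hpq
          (f := fun x => ENNReal.ofReal (F x)) (g := fun x => ENNReal.ofReal (k ‖x - x₀‖))
          (by fun_prop) (by fun_prop)).trans ?_
        gcongr ?_ * ?_ ^ _
        · have h32 : (3 / 2 : ENNReal).toReal = 3 / 2 := by simp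
          rw [eLpNorm_eq_lintegral_rpow_enorm_toReal (by simp)
            (ENNReal.div_ne_top (by simp) (by simp)), h32]
          gcongr ?_ ^ _
          refine (setLIntegral_le_lintegral _ _).trans (lintegral_mono fun x => ?_)
          rw [← Real.enorm_of_nonneg (hF0 x)]
        · rw [← setLIntegral_ball_sub (fun y => ENNReal.ofReal (k ‖y‖ ^ 3)) x₀ r]
          refine setLIntegral_mono (by fun_prop) fun x hx => ?_
          rw [ENNReal.ofReal_pow (hk0 _ (norm_nonneg _) ((mem_ball_iff_norm.1 hx).trans hr))]
          norm_cast

/-- Corollary 1: if `f(·,t) ≥ 0` is measurable for each `t ∈ T` and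
`sup_{t ∈ T} ‖F_γ ∘ f(·,t)‖_{L^{3/2}(ℝ³)} < ∞`, then
`lim_{r → 0+} sup_{t ∈ T} sup_{x₀} ∫_{B_r(x₀)} f(x,t)/|x-x₀| dx = 0`. -/
theorem tendsto_sup_sup_lintegral_div_dist (γ : ℝ) (hγ : 0 < γ) (T : Set ℝ)
    (f : EuclideanSpace ℝ (Fin 3) → ℝ → ℝ)
    (hf : ∀ t ∈ T, Measurable (fun x => f x t))
    (hf0 : ∀ t ∈ T, ∀ x, 0 ≤ f x t)
    (hsup : ∃ K : ℝ, ∀ t ∈ T,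
      eLpNorm (fun x => f x t * Real.log (1 + f x t) ^ (1 + γ)) (3 / 2) volume ≤
        ENNReal.ofReal K) :
    Tendsto (fun r : ℝ => ⨆ t ∈ T, ⨆ x₀ : EuclideanSpace ℝ (Fin 3),
        ∫⁻ x in Metric.ball x₀ r, ENNReal.ofReal (f x t) / ENNReal.ofReal ‖x - x₀‖)
      (𝓝[>] 0) (𝓝 0) := by
  obtain ⟨K, hK⟩ := hsup
  have hA := tendsto_setLIntegral_ball_radial (φ := fun s => s⁻¹ ^ 2) one_pos (by
    have h : IntegrableOn (fun _ : ℝ => (1 : ℝ)) (Set.Ioo 0 1) := by simp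
    refine h.congr_fun (fun s hs => ?_) measurableSet_Ioo
    have := hs.1.ne'
    field_simp)
  have hB := tendsto_setLIntegral_ball_radial (Real.exp_pos (-1))
    integrableOn_inv_mul_neg_log_pow_three
  have hlim := hA.add (ENNReal.Tendsto.const_mul (a := ENNReal.ofReal K)
    ((ENNReal.continuous_rpow_const (y := (1 / 3 : ℝ))).tendsto 0 |>.comp hB)
    (Or.inr ENNReal.ofReal_ne_top))
  rw [ENNReal.zero_rpow_of_pos (by norm_num), mul_zero, add_zero] at hlim
  refine tendsto_of_tendsto_of_tendsto_of_le_of_le' tendsto_const_nhds hlim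
    (Eventually.of_forall fun _ => zero_le) ?_
  filter_upwards [Ioo_mem_nhdsGT (Real.exp_pos (-1))] with r hr
  refine iSup₂_le fun t ht => iSup_le fun x₀ => ?_
  refine (setLIntegral_div_dist_le hγ hr.2 (hf t ht) (hf0 t ht) x₀).trans ?_
  gcongr
  · exact hK t ht
  · exact le_rfl
end

section
/- Let α ∈ [0,1], x₀ ∈ ℝ³, R > 0, and define V(x) = ∫_{B_R(x₀)} |x₀−y|^{−α}·|x−y|^{−1} dy. Then V is twice differentiable away from x₀ and the sphere {|x−x₀| = R}, and its Hessian matrix satisfies: for 0 < |x−x₀| < R, ∇²V(x) = (4π·|x−x₀|^{−α}/(3−α))·( −I + α·(x−x₀)⊗(x−x₀)/|x−x₀|² ), and for |x−x₀| > R, ∇²V(x) = (4π·R^{3−α}/(3−α))·|x−x₀|^{−3}·( −I + 3·(x−x₀)⊗(x−x₀)/|x−x₀|² ). -/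
open MeasureTheory Real

/-- Integral in spherical coordinates of a function of the norm and the first coordinate. The factor
`ENNReal.ofReal (s * sin θ)` vanishes for `θ ≤ 0`, so only the polar angles in `(0, π)` contribute. -/
theorem lintegral_axial (g : ℝ → ℝ → ENNReal) (hg : Measurable (Function.uncurry g)) :
    ∫⁻ y : EuclideanSpace ℝ (Fin 3), g ‖y‖ (y 0) =
      ∫⁻ s in Set.Ioi (0 : ℝ), ∫⁻ θ in Set.Ioo (-π) π,
        ENNReal.ofReal s * (ENNReal.ofReal (2 * π) *
          (ENNReal.ofReal (s * sin θ) * g s (s * cos θ))) := by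
  have hg' {β : Type} [MeasurableSpace β] {u v : β → ℝ} (hu : Measurable u) (hv : Measurable v) :
      Measurable fun b => g (u b) (v b) := hg.comp (hu.prodMk hv)
  have cart : ∫⁻ y : EuclideanSpace ℝ (Fin 3), g ‖y‖ (y 0) =
      ∫⁻ a : ℝ, ∫⁻ q : ℝ × ℝ, g √(a ^ 2 + (q.1 ^ 2 + q.2 ^ 2)) a := by
    rw [← (EuclideanSpace.volume_preserving_symm_measurableEquiv_toLp (Fin 3)).symm.lintegral_comp
        (hg' (by fun_prop) (by fun_prop)),
      ← (volume_preserving_piFinSuccAbove (fun _ : Fin 3 => ℝ) 0).symm.lintegral_comp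
        (hg' (by fun_prop) (by fun_prop)), Measure.volume_eq_prod, lintegral_prod]
    · refine lintegral_congr fun a => ?_
      rw [← (volume_preserving_finTwoArrow ℝ).symm.lintegral_comp_emb
        (MeasurableEquiv.measurableEmbedding _)]
      refine lintegral_congr fun q => ?_
      simp [EuclideanSpace.norm_eq, Fin.sum_univ_three, add_assoc]
    · have hm := (EuclideanSpace.volume_preserving_symm_measurableEquiv_toLp
        (Fin 3)).symm.measurable.comp
          (volume_preserving_piFinSuccAbove (fun _ : Fin 3 => ℝ) 0).symm.measurable
      exact (hg' (measurable_norm.comp hm)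
        ((by fun_prop : Measurable fun y : EuclideanSpace ℝ (Fin 3) => y 0).comp hm)).aemeasurable
  have cyl (a : ℝ) : ∫⁻ q : ℝ × ℝ, g √(a ^ 2 + (q.1 ^ 2 + q.2 ^ 2)) a =
      ∫⁻ ρ : ℝ, ENNReal.ofReal (2 * π) * (ENNReal.ofReal ρ * g √(a ^ 2 + ρ ^ 2) a) := by
    have hpos : ∫⁻ ρ : ℝ, ENNReal.ofReal (2 * π) * (ENNReal.ofReal ρ * g √(a ^ 2 + ρ ^ 2) a) =
        ∫⁻ ρ in Set.Ioi (0 : ℝ),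
          ENNReal.ofReal (2 * π) * (ENNReal.ofReal ρ * g √(a ^ 2 + ρ ^ 2) a) := by
      rw [setLIntegral_eq_of_support_subset]
      intro ρ hρ
      by_contra h
      simp [ENNReal.ofReal_of_nonpos (not_lt.1 h)] at hρ
    rw [hpos, ← lintegral_comp_polarCoord_symm, polarCoord_target, Measure.volume_eq_prod,
      ← Measure.prod_restrict, lintegral_prod]
    · refine lintegral_congr fun ρ => ?_
      have (θ : ℝ) : (ρ * cos θ) ^ 2 + (ρ * sin θ) ^ 2 = ρ ^ 2 := by
        linear_combination ρ ^ 2 * sin_sq_add_cos_sq θ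
      simp only [polarCoord_symm_apply, this, smul_eq_mul, lintegral_const,
        Measure.restrict_apply_univ, Real.volume_Ioo]
      rw [mul_comm]
      ring_nf
    · simp only [polarCoord_symm_apply, smul_eq_mul]
      exact (Measurable.mul (by fun_prop) (hg' (by fun_prop) (by fun_prop))).aemeasurable
  have hm : Measurable fun p : ℝ × ℝ =>
      ENNReal.ofReal (2 * π) * (ENNReal.ofReal p.2 * g √(p.1 ^ 2 + p.2 ^ 2) p.1) :=
    .const_mul (.mul (by fun_prop) (hg' (by fun_prop) (by fun_prop))) _
  simp_rw [cart, cyl]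
  rw [← lintegral_prod (μ := volume) (ν := volume) (fun p : ℝ × ℝ =>
      ENNReal.ofReal (2 * π) * (ENNReal.ofReal p.2 * g √(p.1 ^ 2 + p.2 ^ 2) p.1))
      hm.aemeasurable, ← Measure.volume_eq_prod, ← lintegral_comp_polarCoord_symm,
    polarCoord_target, Measure.volume_eq_prod, ← Measure.prod_restrict, lintegral_prod]
  · refine setLIntegral_congr_fun measurableSet_Ioi fun s hs => ?_
    refine lintegral_congr fun θ => ?_
    have : (s * cos θ) ^ 2 + (s * sin θ) ^ 2 = s ^ 2 := by
      linear_combination s ^ 2 * sin_sq_add_cos_sq θ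
    simp only [polarCoord_symm_apply, this, smul_eq_mul, sqrt_sq (le_of_lt hs)]
  · simp only [polarCoord_symm_apply, smul_eq_mul]
    exact (Measurable.mul (by fun_prop)
      (.const_mul (.mul (by fun_prop) (hg' (by fun_prop) (by fun_prop))) _)).aemeasurable

theorem lintegral_axial_of_norm_eq_one (g : ℝ → ℝ → ENNReal)
    {e : EuclideanSpace ℝ (Fin 3)} (he : ‖e‖ = 1) :
    ∫⁻ y, g ‖y‖ (inner ℝ e y) = ∫⁻ y : EuclideanSpace ℝ (Fin 3), g ‖y‖ (y 0) := by
  obtain ⟨b, hb⟩ := Orthonormal.exists_orthonormalBasis_extension_of_card_eq (𝕜 := ℝ)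
    (E := EuclideanSpace ℝ (Fin 3)) (ι := Fin 3) (by simp) (v := fun _ => e) (s := {0})
    (by
      rw [orthonormal_iff_ite]
      rintro ⟨i, rfl⟩ ⟨j, rfl⟩
      simp [he])
  rw [← b.measurePreserving_repr.lintegral_comp_emb
    b.repr.toHomeomorph.measurableEmbedding (fun y => g ‖y‖ (y 0))]
  simp [b.repr_apply_apply, hb 0 rfl]

/-- The Newtonian kernel integrated over the polar angle on the sphere of radius `s`. -/
theorem lintegral_sphere_newton {r s : ℝ} (hr : 0 < r) (hs : 0 < s) (hrs : s ≠ r) :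
    ∫⁻ θ in Set.Ioo (-π) π, ENNReal.ofReal (s * sin θ) *
      ENNReal.ofReal (√(r ^ 2 - 2 * r * (s * cos θ) + s ^ 2))⁻¹ =
      ENNReal.ofReal (2 * min s r / r) := by
  have hpos (θ : ℝ) : 0 < r ^ 2 - 2 * r * (s * cos θ) + s ^ 2 := by
    have := sq_pos_of_ne_zero (sub_ne_zero.2 hrs)
    nlinarith [mul_nonneg (mul_pos hr hs).le (sub_nonneg.2 (cos_le_one θ))]
  have hdiv (θ : ℝ) : ENNReal.ofReal (s * sin θ) *
      ENNReal.ofReal (√(r ^ 2 - 2 * r * (s * cos θ) + s ^ 2))⁻¹ =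
      ENNReal.ofReal (s * sin θ / √(r ^ 2 - 2 * r * (s * cos θ) + s ^ 2)) := by
    rw [div_eq_mul_inv]
    exact (ENNReal.ofReal_mul' (by positivity)).symm
  simp_rw [hdiv]
  have hcont : Continuous fun θ => s * sin θ / √(r ^ 2 - 2 * r * (s * cos θ) + s ^ 2) :=
    Continuous.div (by fun_prop) (by fun_prop) fun θ => (sqrt_pos.2 (hpos θ)).ne'
  have hint : ∫ θ in (0 : ℝ)..π, s * sin θ / √(r ^ 2 - 2 * r * (s * cos θ) + s ^ 2) =
      2 * min s r / r := by
    rw [intervalIntegral.integral_eq_sub_of_hasDerivAt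
      (f := fun θ => √(r ^ 2 - 2 * r * (s * cos θ) + s ^ 2) / r) _
      (hcont.intervalIntegrable _ _)]
    · have h1 : √(r ^ 2 - 2 * r * (s * cos π) + s ^ 2) = s + r := by
        rw [cos_pi, ← sqrt_sq (by positivity : 0 ≤ s + r)]; ring_nf
      have h2 : √(r ^ 2 - 2 * r * (s * cos 0) + s ^ 2) = |s - r| := by
        rw [cos_zero, ← sqrt_sq_eq_abs]; ring_nf
      rw [h1, h2, ← sub_div]
      congr 1
      rcases le_total s r with h | h
      · rw [min_eq_left h, abs_of_nonpos (sub_nonpos.2 h)]; ring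
      · rw [min_eq_right h, abs_of_nonneg (sub_nonneg.2 h)]; ring
    · intro θ _
      have := ((((hasDerivAt_cos θ).const_mul s).const_mul (2 * r)).const_sub (r ^ 2)
        |>.add_const (s ^ 2) |>.sqrt (hpos θ).ne').div_const r
      refine this.congr_deriv ?_
      field_simp
  have hunion : Set.Ioo (-π) π = Set.Ioc (-π) 0 ∪ Set.Ioo 0 π :=
    (Set.Ioc_union_Ioo_eq_Ioo (by linarith [pi_pos]) pi_pos).symm
  rw [hunion, lintegral_union measurableSet_Ioo
    (Set.disjoint_left.2 fun θ h1 h2 => h2.1.not_ge h1.2),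
    setLIntegral_eq_zero measurableSet_Ioc fun θ hθ => ENNReal.ofReal_of_nonpos ?_, zero_add,
    ← hint, intervalIntegral.integral_of_le pi_pos.le, integral_Ioc_eq_integral_Ioo,
    ofReal_integral_eq_lintegral_ofReal]
  · exact (hcont.integrableOn_Icc).mono_set Set.Ioo_subset_Icc_self
  · refine (ae_restrict_mem measurableSet_Ioo).mono fun θ hθ => ?_
    have := sin_pos_of_mem_Ioo hθ
    show 0 ≤ _
    positivity
  · exact div_nonpos_of_nonpos_of_nonneg (mul_nonpos_of_nonneg_of_nonpos hs.le
      (sin_nonpos_of_nonpos_of_neg_pi_le hθ.2 hθ.1.le)) (sqrt_nonneg _)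

/-- The shell theorem: the Newtonian potential of a radial density. -/
theorem lintegral_radial_mul_inv_norm_sub (f : ℝ → ENNReal) (hf : Measurable f)
    {x : EuclideanSpace ℝ (Fin 3)} (hx : x ≠ 0) :
    ∫⁻ y, f ‖y‖ * ENNReal.ofReal ‖x - y‖⁻¹ =
      ∫⁻ s in Set.Ioi (0 : ℝ), f s * ENNReal.ofReal (4 * π * s * min s ‖x‖ / ‖x‖) := by
  have hr : 0 < ‖x‖ := norm_pos_iff.2 hx
  set r := ‖x‖ with hrdef
  set e := r⁻¹ • x with he
  have he1 : ‖e‖ = 1 := by rw [he, norm_smul, norm_inv, norm_norm, inv_mul_cancel₀ hr.ne']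
  have hker (y : EuclideanSpace ℝ (Fin 3)) :
      ‖x - y‖ = √(r ^ 2 - 2 * r * inner ℝ e y + ‖y‖ ^ 2) := by
    rw [← sqrt_sq (norm_nonneg (x - y)), norm_sub_sq_real, he, real_inner_smul_left]
    congr 3
    field_simp
  let g : ℝ → ℝ → ENNReal := fun s t =>
    f s * ENNReal.ofReal (√(r ^ 2 - 2 * r * t + s ^ 2))⁻¹
  have hg : Measurable (Function.uncurry g) := by
    simp only [Function.uncurry_def, g]
    fun_prop
  calc ∫⁻ y, f ‖y‖ * ENNReal.ofReal ‖x - y‖⁻¹ = ∫⁻ y, g ‖y‖ (inner ℝ e y) := by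
        simp only [hker, g]
    _ = _ := by
        rw [lintegral_axial_of_norm_eq_one g he1, lintegral_axial g hg]
        refine setLIntegral_congr_fun_ae measurableSet_Ioi ?_
        have : ∀ᵐ s : ℝ, s ≠ r := by simp [ae_iff]
        filter_upwards [this] with s hsr hs
        have hs : 0 < s := hs
        have (θ : ℝ) : ENNReal.ofReal s * (ENNReal.ofReal (2 * π) *
            (ENNReal.ofReal (s * sin θ) * g s (s * cos θ))) =
            (ENNReal.ofReal s * ENNReal.ofReal (2 * π) * f s) * (ENNReal.ofReal (s * sin θ) *
              ENNReal.ofReal (√(r ^ 2 - 2 * r * (s * cos θ) + s ^ 2))⁻¹) := by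
          simp only [g]; ring
        simp_rw [this]
        rw [lintegral_const_mul _ (by fun_prop), lintegral_sphere_newton hr hs hsr,
          mul_comm _ (f s), mul_assoc, ← ENNReal.ofReal_mul (by positivity),
          ← ENNReal.ofReal_mul (by positivity)]
        congr 2
        ring

theorem integral_ball_rpow_mul_inv_norm_sub {α R : ℝ} (hα1 : α ≤ 1) (hR : 0 < R)
    {x x₀ : EuclideanSpace ℝ (Fin 3)} (hx : x ≠ x₀) :
    ∫ y in Metric.ball x₀ R, ‖x₀ - y‖ ^ (-α) * ‖x - y‖ ^ (-1 : ℝ) =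
      4 * π / ‖x - x₀‖ * ∫ s in (0 : ℝ)..R, s ^ (1 - α) * min s ‖x - x₀‖ := by
  have hr : 0 < ‖x - x₀‖ := norm_pos_iff.2 (sub_ne_zero.2 hx)
  set r := ‖x - x₀‖
  let F : ℝ → ENNReal := (Set.Iio R).indicator fun s => ENNReal.ofReal (s ^ (-α))
  have hF : Measurable F := Measurable.indicator (by fun_prop) measurableSet_Iio
  have hlin : ∫⁻ y in Metric.ball x₀ R, ENNReal.ofReal (‖x₀ - y‖ ^ (-α) * ‖x - y‖ ^ (-1 : ℝ)) =
      ENNReal.ofReal (∫ s in (0 : ℝ)..R, 4 * π / r * (s ^ (1 - α) * min s r)) := by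
    calc _ = ∫⁻ y, F ‖y - x₀‖ * ENNReal.ofReal ‖(x - x₀) - (y - x₀)‖⁻¹ := by
          rw [← lintegral_indicator Metric.isOpen_ball.measurableSet]
          refine lintegral_congr fun y => ?_
          by_cases hy : ‖y - x₀‖ < R
          · rw [Set.indicator_of_mem (by simpa [dist_eq_norm] using hy)]
            simp only [F]
            rw [Set.indicator_of_mem (by simpa using hy), ← ENNReal.ofReal_mul (by positivity),
              sub_sub_sub_cancel_right, rpow_neg_one, norm_sub_rev x₀ y]
          · rw [Set.indicator_of_notMem (by simpa [dist_eq_norm] using hy)]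
            simp only [F]
            rw [Set.indicator_of_notMem (by simpa using hy), zero_mul]
      _ = ∫⁻ s in Set.Ioi (0 : ℝ), F s * ENNReal.ofReal (4 * π * s * min s r / r) := by
          rw [lintegral_sub_right_eq_self (fun y => F ‖y‖ * ENNReal.ofReal ‖(x - x₀) - y‖⁻¹) x₀,
            lintegral_radial_mul_inv_norm_sub F hF (sub_ne_zero.2 hx)]
      _ = ∫⁻ s in Set.Ioo 0 R, ENNReal.ofReal (4 * π / r * (s ^ (1 - α) * min s r)) := by
          rw [← lintegral_indicator measurableSet_Ioi, ← lintegral_indicator measurableSet_Ioo]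
          refine lintegral_congr fun s => ?_
          by_cases h0 : 0 < s
          · by_cases h1 : s < R
            · rw [Set.indicator_of_mem (by simpa using h0),
                Set.indicator_of_mem (by exact ⟨h0, h1⟩)]
              simp only [F]
              rw [Set.indicator_of_mem (by simpa using h1), ← ENNReal.ofReal_mul (by positivity),
                sub_eq_neg_add, rpow_add_one h0.ne']
              congr 1
              ring
            · simp [F, h0, h1]
          · simp [h0]
      _ = _ := by
          rw [intervalIntegral.integral_of_le hR.le, integral_Ioc_eq_integral_Ioo,
            ofReal_integral_eq_lintegral_ofReal]
          · have : Continuous fun s : ℝ => 4 * π / r * (s ^ (1 - α) * min s r) :=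
              .mul (by fun_prop) (.mul (continuous_id.rpow_const fun _ => .inr (by linarith))
                (by fun_prop))
            exact this.integrableOn_Icc.mono_set Set.Ioo_subset_Icc_self
          · refine (ae_restrict_mem measurableSet_Ioo).mono fun s hs => ?_
            have := hs.1
            show 0 ≤ _
            positivity
  rw [integral_eq_lintegral_of_nonneg_ae (ae_of_all _ fun y => by show 0 ≤ _; positivity)
    (Measurable.aestronglyMeasurable (by fun_prop)), hlin, ENNReal.toReal_ofReal,
    intervalIntegral.integral_const_mul]
  refine intervalIntegral.integral_nonneg hR.le fun s hs => ?_
  have := hs.1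
  positivity

theorem integral_rpow_mul_min_of_le {α R r : ℝ} (hα1 : α ≤ 1) (hr : 0 < r) (hrR : r ≤ R) :
    ∫ s in (0 : ℝ)..R, s ^ (1 - α) * min s r =
      r ^ (3 - α) / (3 - α) + r * (R ^ (2 - α) - r ^ (2 - α)) / (2 - α) := by
  have hcont : Continuous fun s : ℝ => s ^ (1 - α) * min s r :=
    .mul (continuous_id.rpow_const fun _ => .inr (by linarith)) (by fun_prop)
  rw [← intervalIntegral.integral_add_adjacent_intervals (hcont.intervalIntegrable 0 r)
    (hcont.intervalIntegrable r R)]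
  congr 1
  · have : ∫ s in (0 : ℝ)..r, s ^ (1 - α) * min s r = ∫ s in (0 : ℝ)..r, s ^ (2 - α) := by
      refine intervalIntegral.integral_congr fun s hs => ?_
      rw [Set.uIcc_of_le hr.le] at hs
      rw [min_eq_left hs.2, ← rpow_add_one' hs.1 (by linarith)]
      ring_nf
    rw [this, integral_rpow (.inl (by linarith)), zero_rpow (by linarith)]
    ring_nf
  · have : ∫ s in r..R, s ^ (1 - α) * min s r = ∫ s in r..R, s ^ (1 - α) * r := by
      refine intervalIntegral.integral_congr fun s hs => ?_
      rw [Set.uIcc_of_le hrR] at hs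
      rw [min_eq_right hs.1]
    rw [this, intervalIntegral.integral_mul_const, integral_rpow (.inl (by linarith))]
    ring_nf

theorem integral_rpow_mul_min_of_ge {α R r : ℝ} (hα1 : α ≤ 1) (hR : 0 < R) (hrR : R ≤ r) :
    ∫ s in (0 : ℝ)..R, s ^ (1 - α) * min s r = R ^ (3 - α) / (3 - α) := by
  have : ∫ s in (0 : ℝ)..R, s ^ (1 - α) * min s r = ∫ s in (0 : ℝ)..R, s ^ (1 - α) * min s R := by
    refine intervalIntegral.integral_congr fun s hs => ?_
    rw [Set.uIcc_of_le hR.le] at hs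
    rw [min_eq_left hs.2, min_eq_left (hs.2.trans hrR)]
  rw [this, integral_rpow_mul_min_of_le hα1 hR le_rfl]
  simp

section NormRpow

variable {E : Type*} [NormedAddCommGroup E] [InnerProductSpace ℝ E]

theorem hasFDerivAt_norm_sub_rpow (p : ℝ) {x x₀ : E} (hx : x ≠ x₀) :
    HasFDerivAt (fun y => ‖y - x₀‖ ^ p) ((p * ‖x - x₀‖ ^ (p - 2)) • innerSL ℝ (x - x₀)) x := by
  have hr : 0 < ‖x - x₀‖ := norm_pos_iff.2 (sub_ne_zero.2 hx)
  have hpow (y : E) (q : ℝ) : (‖y - x₀‖ ^ 2) ^ q = ‖y - x₀‖ ^ (2 * q) := by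
    rw [← rpow_natCast_mul (norm_nonneg _)]; norm_num
  have h := (((hasFDerivAt_id x).sub_const x₀).norm_sq).rpow_const (p := p / 2)
    (.inl (by simpa using hr.ne'))
  simp only [hpow, id] at h
  rw [show 2 * (p / 2) = p by ring, show 2 * (p / 2 - 1) = p - 2 by ring] at h
  refine h.congr_fderiv ?_
  ext v
  simp
  ring

theorem contDiffAt_and_hessian_of_eventuallyEq_norm_rpow {V : E → ℝ} {C K p : ℝ} {x x₀ : E}
    (hx : x ≠ x₀) (hV : V =ᶠ[nhds x] fun y => C + K * ‖y - x₀‖ ^ p) :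
    ContDiffAt ℝ 2 V x ∧ ∀ u v : E, fderiv ℝ (fun y => fderiv ℝ V y v) x u =
      K * p * ‖x - x₀‖ ^ (p - 2) *
        (inner ℝ u v + (p - 2) * (inner ℝ (x - x₀) u * inner ℝ (x - x₀) v) / ‖x - x₀‖ ^ 2) := by
  have hr : 0 < ‖x - x₀‖ := norm_pos_iff.2 (sub_ne_zero.2 hx)
  refine ⟨?_, fun u v => ?_⟩
  · refine ContDiffAt.congr_of_eventuallyEq ?_ hV
    exact contDiffAt_const.add (contDiffAt_const.mul
      (((contDiffAt_id.sub contDiffAt_const).norm ℝ (sub_ne_zero.2 hx)).rpow_const_of_ne hr.ne'))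
  · have hD : (fun y => fderiv ℝ V y v) =ᶠ[nhds x]
        fun y => K * p * (‖y - x₀‖ ^ (p - 2) * inner ℝ (y - x₀) v) := by
      filter_upwards [hV.eventuallyEq_nhds, isOpen_ne.mem_nhds hx] with y hy hne
      rw [hy.fderiv_eq, (((hasFDerivAt_norm_sub_rpow p hne).const_mul K).const_add C).fderiv]
      simp [inner_sub_left]
      ring
    have h : HasFDerivAt (fun y => K * p * (‖y - x₀‖ ^ (p - 2) * inner ℝ (y - x₀) v)) _ x :=
      ((hasFDerivAt_norm_sub_rpow (p - 2) hx).mul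
        (((hasFDerivAt_id x).sub_const x₀).inner ℝ (hasFDerivAt_const v x))).const_mul (K * p)
    rw [hD.fderiv_eq, h.fderiv]
    simp [inner_sub_left]
    rw [show p - 2 - 2 = p - 2 - (2 : ℕ) by norm_num, rpow_sub_natCast hr.ne']
    field_simp

end NormRpow

/-- Formulas (2.5) and (2.6): the potential
`V(x) = ∫_{B_R(x₀)} |x₀-y|^(-α) |x-y|⁻¹ dy` is twice continuously differentiable away
from `x₀` and the sphere `{|x-x₀| = R}`, with Hessian entries
`∂ᵢ∂ⱼV(x) = (4π|x-x₀|^(-α)/(3-α)) (-δᵢⱼ + α (x-x₀)ᵢ(x-x₀)ⱼ/|x-x₀|²)` for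
`0 < |x-x₀| < R`, and
`∂ᵢ∂ⱼV(x) = (4πR^(3-α)/(3-α)) |x-x₀|⁻³ (-δᵢⱼ + 3 (x-x₀)ᵢ(x-x₀)ⱼ/|x-x₀|²)` for
`|x-x₀| > R`. -/
theorem hessian_of_ball_potential (α : ℝ) (hα0 : 0 ≤ α) (hα1 : α ≤ 1)
    (x₀ : EuclideanSpace ℝ (Fin 3)) (R : ℝ) (hR : 0 < R)
    (V : EuclideanSpace ℝ (Fin 3) → ℝ)
    (hV : ∀ x, V x = ∫ y in Metric.ball x₀ R, ‖x₀ - y‖ ^ (-α) * ‖x - y‖ ^ (-1 : ℝ)) :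
    (∀ x : EuclideanSpace ℝ (Fin 3), x ≠ x₀ → ‖x - x₀‖ ≠ R → ContDiffAt ℝ 2 V x) ∧
    (∀ x : EuclideanSpace ℝ (Fin 3), 0 < ‖x - x₀‖ → ‖x - x₀‖ < R → ∀ i j : Fin 3,
      fderiv ℝ (fun y => fderiv ℝ V y (EuclideanSpace.single j 1)) x
          (EuclideanSpace.single i 1) =
        4 * π * ‖x - x₀‖ ^ (-α) / (3 - α) *
          (-(if i = j then 1 else 0) + α * ((x - x₀) i * (x - x₀) j) / ‖x - x₀‖ ^ 2)) ∧
    (∀ x : EuclideanSpace ℝ (Fin 3), R < ‖x - x₀‖ → ∀ i j : Fin 3,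
      fderiv ℝ (fun y => fderiv ℝ V y (EuclideanSpace.single j 1)) x
          (EuclideanSpace.single i 1) =
        4 * π * R ^ (3 - α) / (3 - α) * ‖x - x₀‖ ^ (-3 : ℝ) *
          (-(if i = j then 1 else 0) + 3 * ((x - x₀) i * (x - x₀) j) / ‖x - x₀‖ ^ 2)) := by
  have hVeq (x : EuclideanSpace ℝ (Fin 3)) (hx : x ≠ x₀) :=
    (hV x).trans (integral_ball_rpow_mul_inv_norm_sub hα1 hR hx)
  have hcont : Continuous fun y : EuclideanSpace ℝ (Fin 3) => ‖y - x₀‖ := by fun_prop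
  have hin (x : EuclideanSpace ℝ (Fin 3)) (hx : x ≠ x₀) (hxR : ‖x - x₀‖ < R) :=
    contDiffAt_and_hessian_of_eventuallyEq_norm_rpow (V := V) (p := 2 - α)
      (C := 4 * π * R ^ (2 - α) / (2 - α)) (K := -(4 * π / ((3 - α) * (2 - α)))) hx (by
        filter_upwards [isOpen_ne.mem_nhds hx, (isOpen_lt hcont continuous_const).mem_nhds hxR]
          with y hy hyR
        have hr : 0 < ‖y - x₀‖ := norm_pos_iff.2 (sub_ne_zero.2 hy)
        rw [hVeq y hy, integral_rpow_mul_min_of_le hα1 hr (le_of_lt hyR),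
          show 3 - α = 2 - α + 1 by ring, rpow_add_one hr.ne']
        have h2 : 2 - α ≠ 0 := by linarith
        have h3 : 2 - α + 1 ≠ 0 := by linarith
        field_simp
        ring)
  have hout (x : EuclideanSpace ℝ (Fin 3)) (hx : x ≠ x₀) (hxR : R < ‖x - x₀‖) :=
    contDiffAt_and_hessian_of_eventuallyEq_norm_rpow (V := V) (p := -1)
      (C := 0) (K := 4 * π * R ^ (3 - α) / (3 - α)) hx (by
        filter_upwards [isOpen_ne.mem_nhds hx, (isOpen_lt continuous_const hcont).mem_nhds hxR]
          with y hy hyR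
        rw [hVeq y hy, integral_rpow_mul_min_of_ge hα1 hR (le_of_lt hyR), rpow_neg_one]
        ring)
  refine ⟨fun x hx hxR => ?_, fun x h0 hxR i j => ?_, fun x hxR i j => ?_⟩
  · rcases lt_or_gt_of_ne hxR with h | h
    · exact (hin x hx h).1
    · exact (hout x hx h).1
  · have h2 : 2 - α ≠ 0 := by linarith
    have h3 : 3 - α ≠ 0 := by linarith
    rw [(hin x (sub_ne_zero.1 (norm_pos_iff.1 h0)) hxR).2]
    simp [EuclideanSpace.inner_single_right, eq_comm (a := j) (b := i)]
    field_simp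
    ring
  · have h0 : 0 < ‖x - x₀‖ := hR.trans hxR
    rw [(hout x (sub_ne_zero.1 (norm_pos_iff.1 h0)) hxR).2]
    simp [EuclideanSpace.inner_single_right, eq_comm (a := j) (b := i)]
    norm_num
    ring
end
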